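/- arXiv:1103.0392 — 7 statements merged into one kernel-verified Lean document; each statement's English description precedes it below -/
import Mathlib

section
/- Let T > 0 and let y : [0,T] → ℝ be a continuous function with y(0) ≥ 0. Define k(t) = sup_{0 ≤ s ≤ t} (y(s))⁻ and x(t) = y(t) + k(t) for t ∈ [0,T]. Then k is continuous and nondecreasing with k(0) = 0, x is continuous and nonnegative on [0,T], and the Lebesgue–Stieltjes integral ∫_0^T x dk equals 0. -/
open MeasureTheory Set

/-- `μ` is the Lebesgue–Stieltjes measure associated to the nondecreasing continuous
function `k` on `[0,T]`, characterized by `μ((a,b]) = k b - k a`. -/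
def IsStieltjesMeasureOn (k : ℝ → ℝ) (T : ℝ) (μ : Measure ℝ) : Prop :=
  ∀ a b : ℝ, 0 ≤ a → a ≤ b → b ≤ T → μ (Ioc a b) = ENNReal.ofReal (k b - k a)

/-- The running supremum of a continuous function on `[0,T]` is continuous. -/
theorem ContinuousOn.sSup_image_Icc_zero {T : ℝ} (hT : 0 ≤ T) {f : ℝ → ℝ}
    (hf : ContinuousOn f (Icc 0 T)) :
    ContinuousOn (fun t => sSup (f '' Icc 0 t)) (Icc 0 T) := by
  have hg : Continuous (IccExtend hT ((Icc 0 T).domRestrict f)) :=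
    (continuousOn_iff_continuous_domRestrict.1 hf).Icc_extend'
  have hsup : Continuous fun t : ℝ =>
      sSup ((fun u : ℝ => IccExtend hT ((Icc 0 T).domRestrict f) (t * u)) '' Icc 0 1) :=
    isCompact_Icc.continuous_sSup
      (f := fun t u : ℝ => IccExtend hT ((Icc 0 T).domRestrict f) (t * u))
      (hg.comp (continuous_fst.mul continuous_snd))
  refine hsup.continuousOn.congr fun t ht => ?_
  have himage : (fun u : ℝ => t * u) '' Icc 0 1 = Icc 0 t := by
    simpa using image_mul_left_Icc ht.1 (zero_le_one' ℝ)
  have hcomp := image_comp (IccExtend hT ((Icc 0 T).domRestrict f)) (fun u : ℝ => t * u) (Icc 0 1)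
  simp only [Function.comp_def] at hcomp
  simp only [hcomp, himage]
  congr 1
  refine image_congr fun s hs => ?_
  exact (IccExtend_of_mem hT ((Icc 0 T).domRestrict f) (Icc_subset_Icc_right ht.2 hs)).symm

/-- If `k` is locally constant in `[0,T]` at every point of `(0,T]` where `x` does not vanish,
then `x` has zero integral against the Lebesgue–Stieltjes measure of `k`. -/
theorem IsStieltjesMeasureOn.setIntegral_eq_zero {k x : ℝ → ℝ} {T : ℝ} {μ : Measure ℝ}
    (hμ : IsStieltjesMeasureOn k T μ)
    (hloc : ∀ t ∈ Ioc 0 T, x t ≠ 0 → ∃ δ > 0, k (max (t - δ) 0) = k (min (t + δ) T)) :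
    ∫ t in Ioc 0 T, x t ∂μ = 0 := by
  have hnull : μ {t | t ∈ Ioc 0 T ∧ x t ≠ 0} = 0 := by
    refine measure_null_of_locally_null _ fun t ht => ?_
    obtain ⟨δ, hδ, hkδ⟩ := hloc t ht.1 ht.2
    refine ⟨Ioc (max (t - δ) 0) (min (t + δ) T), ?_, ?_⟩
    · refine mem_nhdsWithin.2 ⟨Ioo (t - δ) (t + δ), isOpen_Ioo, ⟨by linarith, by linarith⟩, ?_⟩
      rintro s ⟨hs, hsT, -⟩
      exact ⟨max_lt hs.1 hsT.1, le_min hs.2.le hsT.2⟩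
    · have hab : max (t - δ) 0 ≤ min (t + δ) T :=
        (max_le (by linarith) ht.1.1.le).trans (le_min (by linarith) ht.1.2)
      rw [hμ _ _ (le_max_right _ _) hab (min_le_right _ _), hkδ, sub_self, ENNReal.ofReal_zero]
  refine integral_eq_zero_of_ae ((ae_restrict_iff' measurableSet_Ioc).2 ?_)
  rw [ae_iff]
  simpa only [Pi.zero_apply, Classical.not_imp] using hnull

/-- Skorokhod problem on the half-line: existence part.  With
`k t = sup_{0 ≤ s ≤ t} (y s)⁻` and `x = y + k`, the function `k` is continuous,
nondecreasing, starts from `0`, `x` is continuous and nonnegative on `[0,T]`, and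
the Lebesgue–Stieltjes integral `∫_0^T x dk` vanishes. -/
theorem skorokhod_halfline_existence
    (T : ℝ) (hT : 0 < T) (y : ℝ → ℝ) (hy : ContinuousOn y (Icc 0 T)) (hy0 : 0 ≤ y 0)
    (k x : ℝ → ℝ)
    (hk : ∀ t ∈ Icc 0 T, k t = sSup ((fun s => max (-(y s)) 0) '' Icc 0 t))
    (hx : ∀ t ∈ Icc 0 T, x t = y t + k t) :
    ContinuousOn k (Icc 0 T) ∧ MonotoneOn k (Icc 0 T) ∧ k 0 = 0 ∧
      ContinuousOn x (Icc 0 T) ∧ (∀ t ∈ Icc 0 T, 0 ≤ x t) ∧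
      ∀ μ : Measure ℝ, IsStieltjesMeasureOn k T μ →
        ∫ t in Ioc 0 T, x t ∂μ = 0 := by
  set f : ℝ → ℝ := fun s => max (-(y s)) 0 with hf_def
  have hf : ContinuousOn f (Icc 0 T) := hy.fun_neg.sup continuousOn_const
  have hbdd : ∀ t ∈ Icc 0 T, BddAbove (f '' Icc 0 t) := fun t ht =>
    isCompact_Icc.bddAbove_image (hf.mono (Icc_subset_Icc_right ht.2))
  have hle : ∀ t ∈ Icc 0 T, ∀ s ∈ Icc 0 t, f s ≤ k t := fun t ht s hs => by
    rw [hk t ht]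
    exact le_csSup (hbdd t ht) (mem_image_of_mem f hs)
  have hkle : ∀ t ∈ Icc 0 T, ∀ c, (∀ s ∈ Icc 0 t, f s ≤ c) → k t ≤ c := fun t ht c hc => by
    rw [hk t ht]
    exact csSup_le ((nonempty_Icc.2 ht.1).image f) (forall_mem_image.2 hc)
  have hkc : ContinuousOn k (Icc 0 T) := (hf.sSup_image_Icc_zero hT.le).congr hk
  have hkm : MonotoneOn k (Icc 0 T) := fun a ha b hb hab =>
    hkle a ha _ fun s hs => hle b hb s ⟨hs.1, hs.2.trans hab⟩
  have hk0 : k 0 = 0 := by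
    rw [hk 0 ⟨le_rfl, hT.le⟩]
    simp [hf_def, hy0]
  have hxnonneg : ∀ t ∈ Icc 0 T, 0 ≤ x t := fun t ht => by
    have h := (le_max_left (-(y t)) 0).trans (hle t ht t ⟨ht.1, le_rfl⟩)
    rw [hx t ht]
    linarith
  refine ⟨hkc, hkm, hk0, (hy.add hkc).congr hx, hxnonneg, fun μ hμ =>
    hμ.setIntegral_eq_zero fun t ht hxt => ?_⟩
  have htT : t ∈ Icc 0 T := Ioc_subset_Icc_self ht
  have hpos : 0 < x t / 2 := half_pos ((hxnonneg t htT).lt_of_ne' hxt)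
  obtain ⟨δ₁, hδ₁, hyδ⟩ := Metric.continuousOn_iff.1 hy t htT _ hpos
  obtain ⟨δ₂, hδ₂, hkδ⟩ := Metric.continuousOn_iff.1 hkc t htT _ hpos
  obtain ⟨δ, hδ, hδlt⟩ := exists_between (lt_min hδ₁ hδ₂)
  refine ⟨δ, hδ, ?_⟩
  have hat : max (t - δ) 0 ≤ t := max_le (by linarith) ht.1.le
  have htb : t ≤ min (t + δ) T := le_min (by linarith) ht.2
  have ha : max (t - δ) 0 ∈ Icc 0 T := ⟨le_max_right _ _, hat.trans ht.2⟩
  have hb : min (t + δ) T ∈ Icc 0 T := ⟨ht.1.le.trans htb, min_le_right _ _⟩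
  have hdist : ∀ s ∈ Icc (max (t - δ) 0) (min (t + δ) T), dist s t ≤ δ := fun s hs => by
    have h₁ := (le_max_left _ _).trans hs.1
    have h₂ := hs.2.trans (min_le_left _ _)
    rw [Real.dist_eq, abs_le]
    constructor <;> linarith
  refine (hkm ha hb (hat.trans htb)).antisymm (hkle _ hb _ fun s hs => ?_)
  rcases le_total s (max (t - δ) 0) with hsa | has
  · exact hle _ ha s ⟨hs.1, hsa⟩
  · have hys := hyδ s ⟨hs.1, hs.2.trans hb.2⟩
      ((hdist s ⟨has, hs.2⟩).trans_lt (hδlt.trans_le (min_le_left _ _)))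
    have hka := hkδ _ ha
      ((hdist _ ⟨le_rfl, hat.trans htb⟩).trans_lt (hδlt.trans_le (min_le_right _ _)))
    rw [Real.dist_eq, abs_lt] at hys hka
    have hxeq := hx t htT
    exact max_le (by linarith) (hk0.symm.le.trans (hkm ⟨le_rfl, hT.le⟩ ha ha.1))
end

section
/- Let T > 0 and let y : [0,T] → ℝ be a continuous function with y(0) ≥ 0. Suppose (x, k) and (x̃, k̃) are two pairs of functions on [0,T] such that: x = y + k and x̃ = y + k̃; x and x̃ are continuous and nonnegative; k and k̃ are continuous, nondecreasing with k(0) = k̃(0) = 0; and the Lebesgue–Stieltjes integrals ∫_0^T x dk and ∫_0^T x̃ dk̃ both equal 0. Then x(t) = x̃(t) and k(t) = k̃(t) for all t ∈ [0,T]. -/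
open MeasureTheory Set

/-- A set on which a nonnegative continuous `x` with `∫ x dμ = 0` is positive is `μ`-null. -/
lemma IsStieltjesMeasureOn.measure_eq_zero_of_pos {T : ℝ} {x k : ℝ → ℝ} {μ : Measure ℝ}
    (hT : 0 ≤ T) (hμ : IsStieltjesMeasureOn k T μ) (hxc : ContinuousOn x (Icc 0 T))
    (hxnn : ∀ t ∈ Icc 0 T, 0 ≤ x t) (hi : ∫ t in Ioc 0 T, x t ∂μ = 0)
    {s : Set ℝ} (hs : s ⊆ Ioc 0 T) (hpos : ∀ t ∈ s, 0 < x t) : μ s = 0 := by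
  have hfin : μ (Ioc 0 T) ≠ ⊤ := by
    rw [hμ 0 T le_rfl hT le_rfl]
    exact ENNReal.ofReal_ne_top
  obtain ⟨C, hC⟩ := isCompact_Icc.exists_bound_of_continuousOn hxc
  have hint : IntegrableOn x (Ioc 0 T) μ := by
    have : IsFiniteMeasure (μ.restrict (Ioc 0 T)) := isFiniteMeasure_restrict.2 hfin
    refine Integrable.of_bound
      ((hxc.mono Ioc_subset_Icc_self).aestronglyMeasurable measurableSet_Ioc) C ?_
    exact ae_restrict_of_forall_mem measurableSet_Ioc fun t ht => hC t (Ioc_subset_Icc_self ht)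
  have hnn : 0 ≤ᵐ[μ.restrict (Ioc 0 T)] x :=
    ae_restrict_of_forall_mem measurableSet_Ioc fun t ht => hxnn t (Ioc_subset_Icc_self ht)
  have hzero := (ae_restrict_iff' measurableSet_Ioc).1
    ((setIntegral_eq_zero_iff_of_nonneg_ae hnn hint).1 hi)
  refine measure_mono_null (fun t ht => ?_) (ae_iff.1 hzero)
  exact fun h => (hpos t ht).ne' (h (hs ht))

/-- The regulator of a solution of the Skorokhod problem on the half-line is dominated by
every nondecreasing continuous `k'` that keeps `y + k'` nonnegative. -/
lemma IsStieltjesMeasureOn.le_of_skorokhod {T : ℝ} {y x k x' k' : ℝ → ℝ} {μ : Measure ℝ}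
    (hxk : ∀ t ∈ Icc 0 T, x t = y t + k t) (hxk' : ∀ t ∈ Icc 0 T, x' t = y t + k' t)
    (hxc : ContinuousOn x (Icc 0 T))
    (hxnn : ∀ t ∈ Icc 0 T, 0 ≤ x t) (hxnn' : ∀ t ∈ Icc 0 T, 0 ≤ x' t)
    (hkc : ContinuousOn k (Icc 0 T)) (hkc' : ContinuousOn k' (Icc 0 T))
    (hkm' : MonotoneOn k' (Icc 0 T)) (hk0 : k 0 ≤ k' 0)
    (hμ : IsStieltjesMeasureOn k T μ) (hi : ∫ t in Ioc 0 T, x t ∂μ = 0)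
    {t : ℝ} (ht : t ∈ Icc 0 T) : k t ≤ k' t := by
  have hsub : Icc 0 t ⊆ Icc 0 T := Icc_subset_Icc_right ht.2
  have hcpt : IsCompact {u ∈ Icc 0 t | k u ≤ k' u} :=
    isCompact_Icc.of_isClosed_subset
      (isClosed_Icc.isClosed_le (hkc.mono hsub) (hkc'.mono hsub)) (sep_subset _ _)
  obtain ⟨s, ⟨hst, hks⟩, hmax⟩ := hcpt.exists_isGreatest ⟨0, ⟨le_rfl, ht.1⟩, hk0⟩
  have hnull : μ (Ioc s t) = 0 := by
    refine hμ.measure_eq_zero_of_pos (ht.1.trans ht.2) hxc hxnn hi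
      (Ioc_subset_Ioc hst.1 ht.2) fun u hu => ?_
    have hut : u ∈ Icc 0 t := ⟨hst.1.trans hu.1.le, hu.2⟩
    have hlt : k' u < k u := not_le.1 fun h => hu.1.not_ge (hmax ⟨hut, h⟩)
    linarith [hxk u (hsub hut), hxk' u (hsub hut), hxnn' u (hsub hut)]
  rw [hμ s t hst.1 hst.2 ht.2, ENNReal.ofReal_eq_zero] at hnull
  linarith [hkm' (hsub hst) ht hst.2]

/-- Skorokhod problem on the half-line: uniqueness part.  Two solutions
`(x, k)` and `(x', k')` of the Skorokhod problem for the same continuous `y`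
with `y 0 ≥ 0` coincide on `[0,T]`. -/
theorem skorokhod_halfline_uniqueness
    (T : ℝ) (hT : 0 < T) (y : ℝ → ℝ) (hy : ContinuousOn y (Icc 0 T)) (hy0 : 0 ≤ y 0)
    (x k x' k' : ℝ → ℝ)
    (hxk : ∀ t ∈ Icc 0 T, x t = y t + k t)
    (hxk' : ∀ t ∈ Icc 0 T, x' t = y t + k' t)
    (hxc : ContinuousOn x (Icc 0 T)) (hxc' : ContinuousOn x' (Icc 0 T))
    (hxnn : ∀ t ∈ Icc 0 T, 0 ≤ x t) (hxnn' : ∀ t ∈ Icc 0 T, 0 ≤ x' t)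
    (hkc : ContinuousOn k (Icc 0 T)) (hkc' : ContinuousOn k' (Icc 0 T))
    (hkm : MonotoneOn k (Icc 0 T)) (hkm' : MonotoneOn k' (Icc 0 T))
    (hk0 : k 0 = 0) (hk0' : k' 0 = 0)
    (μ μ' : Measure ℝ)
    (hμ : IsStieltjesMeasureOn k T μ) (hμ' : IsStieltjesMeasureOn k' T μ')
    (hi : ∫ t in Ioc 0 T, x t ∂μ = 0) (hi' : ∫ t in Ioc 0 T, x' t ∂μ' = 0) :
    ∀ t ∈ Icc 0 T, x t = x' t ∧ k t = k' t := by
  intro t ht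
  have hk : k t = k' t := le_antisymm
    (hμ.le_of_skorokhod hxk hxk' hxc hxnn hxnn' hkc hkc' hkm' (hk0.trans hk0'.symm).le hi ht)
    (hμ'.le_of_skorokhod hxk' hxk hxc' hxnn' hxnn hkc' hkc hkm (hk0'.trans hk0.symm).le hi' ht)
  exact ⟨by rw [hxk t ht, hxk' t ht, hk], hk⟩
end

section
/- Let T > 0, let y : [0,T] → ℝ be continuous, and let k' : [0,T] → ℝ be any continuous nondecreasing function with k'(0) ≥ 0 such that y(t) + k'(t) ≥ 0 for all t ∈ [0,T]. Then k'(t) ≥ sup_{0 ≤ s ≤ t} (y(s))⁻ for every t ∈ [0,T]; that is, the reflecting term k(t) = sup_{0 ≤ s ≤ t} (y(s))⁻ of the Skorokhod problem is the minimal nondecreasing function keeping y + k nonnegative. -/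
open Set

/-- Minimality of the reflecting term of the Skorokhod problem: any continuous
nondecreasing `k'` with `k' 0 ≥ 0` keeping `y + k'` nonnegative on `[0,T]`
dominates `t ↦ sup_{0 ≤ s ≤ t} (y s)⁻`. -/
theorem skorokhod_reflector_minimal
    (T : ℝ) (hT : 0 < T) (y k' : ℝ → ℝ) (hy : ContinuousOn y (Icc 0 T))
    (hk'c : ContinuousOn k' (Icc 0 T)) (hk'm : MonotoneOn k' (Icc 0 T))
    (hk'0 : 0 ≤ k' 0)
    (hpos : ∀ t ∈ Icc 0 T, 0 ≤ y t + k' t) :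
    ∀ t ∈ Icc 0 T, sSup ((fun s => max (-(y s)) 0) '' Icc 0 t) ≤ k' t := by
  intro t ht
  refine csSup_le ((nonempty_Icc.2 ht.1).image _) ?_
  rintro _ ⟨s, hs, rfl⟩
  have hsT : s ∈ Icc 0 T := ⟨hs.1, hs.2.trans ht.2⟩
  have h0T : (0 : ℝ) ∈ Icc 0 T := left_mem_Icc.2 hT.le
  have hst : k' s ≤ k' t := hk'm hsT ht hs.2
  have h0t : k' 0 ≤ k' t := hk'm h0T ht ht.1
  have hs_nonneg : 0 ≤ y s + k' s := hpos s hsT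
  exact max_le (by linarith) (by linarith)
end

section
/- Let T > 0 and let y, s : [0,T] → ℝ be continuous functions with y(0) ≥ s(0). Define k(t) = sup_{0 ≤ u ≤ t} (y(u) − s(u))⁻ and x(t) = y(t) + k(t) for t ∈ [0,T]. Then k is continuous and nondecreasing with k(0) = 0, x is continuous with x(t) ≥ s(t) for all t ∈ [0,T], and the Lebesgue–Stieltjes integral ∫_0^T (x − s) dk equals 0. -/
open MeasureTheory Set

open Filter Topology

theorem continuousOn_runningSup {f : ℝ → ℝ} {T : ℝ} (hT : 0 ≤ T)
    (hf : ContinuousOn f (Icc 0 T)) :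
    ContinuousOn (fun t => sSup (f '' Icc 0 t)) (Icc 0 T) := by
  have hF : Continuous (IccExtend hT ((Icc 0 T).domRestrict f)) :=
    hf.domRestrict.Icc_extend'
  have hc : Continuous fun t : ℝ =>
      sSup ((fun r => IccExtend hT ((Icc 0 T).domRestrict f) (r * t)) '' Icc (0 : ℝ) 1) :=
    isCompact_Icc.continuous_sSup (by fun_prop)
  refine hc.continuousOn.congr fun t ht => ?_
  have himage : Icc 0 t = (fun r => r * t) '' Icc (0 : ℝ) 1 := by
    rw [Set.image_mul_right_Icc zero_le_one ht.1, zero_mul, one_mul]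
  dsimp only
  rw [← Set.image_image (IccExtend hT ((Icc 0 T).domRestrict f)) (fun r => r * t), ← himage]
  congr 1
  refine Set.image_congr fun u hu => ?_
  exact (IccExtend_of_mem hT ((Icc 0 T).domRestrict f) ⟨hu.1, hu.2.trans ht.2⟩).symm

theorem isLUB_runningSup {f : ℝ → ℝ} {T t : ℝ} (hf : ContinuousOn f (Icc 0 T))
    (ht : t ∈ Icc 0 T) : IsLUB (f '' Icc 0 t) (sSup (f '' Icc 0 t)) :=
  isLUB_csSup ((nonempty_Icc.2 ht.1).image f)
    (isCompact_Icc.image_of_continuousOn (hf.mono (Icc_subset_Icc_right ht.2))).bddAbove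

/-- The Stieltjes measure of `k` does not charge a set near each point of which `k` is
locally nonincreasing. -/
theorem IsStieltjesMeasureOn.null_of_locally_le {k : ℝ → ℝ} {T : ℝ} {μ : Measure ℝ}
    (hμ : IsStieltjesMeasureOn k T μ) {s : Set ℝ} (hs : s ⊆ Ioc 0 T)
    (hk : ∀ t ∈ s, ∃ U ∈ 𝓝[Icc 0 T] t, ∀ a ∈ U, ∀ b ∈ U, a ≤ b → k b ≤ k a) :
    μ s = 0 := by
  refine measure_null_of_locally_null s fun t ht => ?_
  obtain ⟨U, hU, hUk⟩ := hk t ht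
  obtain ⟨ε, hε, hball⟩ := Metric.mem_nhdsWithin_iff.1 hU
  obtain ⟨ht0, htT⟩ := hs ht
  refine ⟨Ioc (max 0 (t - ε / 2)) (min T (t + ε / 2)), ?_, ?_⟩
  · refine mem_nhdsWithin.2 ⟨Ioo (t - ε / 2) (t + ε / 2), isOpen_Ioo,
      ⟨by linarith, by linarith⟩, fun u hu => ?_⟩
    exact ⟨max_lt (hs hu.2).1 hu.1.1, le_min (hs hu.2).2 hu.1.2.le⟩
  · have hat : max 0 (t - ε / 2) ≤ t := max_le ht0.le (by linarith)
    have htb : t ≤ min T (t + ε / 2) := le_min htT (by linarith)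
    have ha0 : 0 ≤ max 0 (t - ε / 2) := le_max_left _ _
    have hbT : min T (t + ε / 2) ≤ T := min_le_left _ _
    have ha : t - ε / 2 ≤ max 0 (t - ε / 2) := le_max_right _ _
    have hb : min T (t + ε / 2) ≤ t + ε / 2 := min_le_right _ _
    rw [hμ _ _ ha0 (hat.trans htb) hbT, ENNReal.ofReal_eq_zero, sub_nonpos]
    refine hUk _ (hball ⟨?_, ha0, hat.trans htT⟩) _ (hball ⟨?_, ht0.le.trans htb, hbT⟩)
      (hat.trans htb)
    all_goals
      rw [Metric.mem_ball, Real.dist_eq, abs_lt]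
      constructor <;> linarith

/-- Skorokhod problem with a continuous lower obstacle `S`: existence part.
With `k t = sup_{0 ≤ u ≤ t} (y u - S u)⁻` and `x = y + k`, the function `k` is
continuous, nondecreasing, starts from `0`, `x` is continuous with `x ≥ S` on
`[0,T]`, and the Lebesgue–Stieltjes integral `∫_0^T (x - S) dk` vanishes. -/
theorem skorokhod_obstacle_existence
    (T : ℝ) (hT : 0 < T) (y S : ℝ → ℝ)
    (hy : ContinuousOn y (Icc 0 T)) (hS : ContinuousOn S (Icc 0 T))
    (h0 : S 0 ≤ y 0)
    (k x : ℝ → ℝ)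
    (hk : ∀ t ∈ Icc 0 T, k t = sSup ((fun u => max (-(y u - S u)) 0) '' Icc 0 t))
    (hx : ∀ t ∈ Icc 0 T, x t = y t + k t) :
    ContinuousOn k (Icc 0 T) ∧ MonotoneOn k (Icc 0 T) ∧ k 0 = 0 ∧
      ContinuousOn x (Icc 0 T) ∧ (∀ t ∈ Icc 0 T, S t ≤ x t) ∧
      ∀ μ : Measure ℝ, IsStieltjesMeasureOn k T μ →
        ∫ t in Ioc 0 T, (x t - S t) ∂μ = 0 := by
  set f : ℝ → ℝ := fun u => max (-(y u - S u)) 0 with hf_def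
  have hf : ContinuousOn f (Icc 0 T) := (hy.sub hS).neg.sup continuousOn_const
  have hkc : ContinuousOn k (Icc 0 T) := (continuousOn_runningSup hT.le hf).congr hk
  have hlub : ∀ t ∈ Icc 0 T, IsLUB (f '' Icc 0 t) (k t) := fun t ht =>
    hk t ht ▸ isLUB_runningSup hf ht
  have hfk : ∀ t ∈ Icc 0 T, ∀ u ∈ Icc 0 t, f u ≤ k t := fun t ht u hu =>
    (hlub t ht).1 (mem_image_of_mem f hu)
  have hf0 : ∀ u, 0 ≤ f u := fun u => le_max_right _ _
  have hk0 : ∀ t ∈ Icc 0 T, 0 ≤ k t := fun t ht =>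
    (hf0 t).trans (hfk t ht t ⟨ht.1, le_rfl⟩)
  have hxS : ∀ t ∈ Icc 0 T, S t ≤ x t := fun t ht => by
    have h : -(y t - S t) ≤ k t := (le_max_left _ _).trans (hfk t ht t ⟨ht.1, le_rfl⟩)
    rw [hx t ht]
    linarith
  refine ⟨hkc, fun a ha b hb hab => (hlub a ha).mono (hlub b hb) (by gcongr), ?_,
    (hy.add hkc).congr hx, hxS, fun μ hμ => ?_⟩
  · rw [hk 0 ⟨le_rfl, hT.le⟩, Icc_self, image_singleton, csSup_singleton]
    exact max_eq_right (by linarith)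
  have hnull : μ {t | t ∈ Ioc 0 T ∧ S t < x t} = 0 := by
    refine hμ.null_of_locally_le (fun t ht => ht.1) fun t ⟨ht, hlt⟩ => ?_
    have htI : t ∈ Icc 0 T := Ioc_subset_Icc_self ht
    rw [hx t htI] at hlt
    obtain ⟨c, hc⟩ : ∃ c, ∀ᶠ u in 𝓝[Icc 0 T] t, f u ≤ c ∧ c ≤ k u := by
      rcases (hk0 t htI).eq_or_lt with h | h
      · have hneg : -(y t - S t) < 0 := by linarith
        refine ⟨0, ?_⟩
        filter_upwards [((hy.sub hS).neg t htI).eventually_lt_const hneg,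
          self_mem_nhdsWithin] with u hu huI
        exact ⟨max_le hu.le le_rfl, hk0 u huI⟩
      · obtain ⟨c, hfc, hck⟩ := exists_between (show f t < k t from max_lt (by linarith) h)
        refine ⟨c, ?_⟩
        filter_upwards [(hf t htI).eventually_lt_const hfc,
          (hkc t htI).eventually_const_lt hck] with u h₁ h₂
        exact ⟨h₁.le, h₂.le⟩
    -- Convexity of the neighbourhood makes `f` at most `c` between any two of its points.
    obtain ⟨ε, hε, hball⟩ := Metric.mem_nhdsWithin_iff.1 hc
    refine ⟨Metric.ball t ε ∩ Icc 0 T,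
      inter_mem (mem_nhdsWithin_of_mem_nhds (Metric.ball_mem_nhds t hε)) self_mem_nhdsWithin,
      fun a ha b hb _ => (hlub b hb.2).2 ?_⟩
    rintro _ ⟨w, hw, rfl⟩
    rcases le_total w a with hwa | haw
    · exact hfk a ha.2 w ⟨hw.1, hwa⟩
    · have hwball : w ∈ Metric.ball t ε :=
        (convex_ball t ε).ordConnected.out ha.1 hb.1 ⟨haw, hw.2⟩
      exact (hball ⟨hwball, hw.1, hw.2.trans hb.2.2⟩).1.trans (hball ha).2
  refine integral_eq_zero_of_ae ((ae_restrict_iff' measurableSet_Ioc).2 ?_)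
  filter_upwards [measure_eq_zero_iff_ae_notMem.1 hnull] with t ht htI
  have h := hxS t (Ioc_subset_Icc_self htI)
  have h' : x t ≤ S t := not_lt.1 fun hlt => ht ⟨htI, hlt⟩
  exact sub_eq_zero.2 (h'.antisymm h)
end

section
/- Let T > 0 and let y, s : [0,T] → ℝ be continuous functions with y(0) ≥ s(0). Suppose (x, k) is a pair of functions on [0,T] such that x = y + k, x is continuous with x(t) ≥ s(t) for all t, k is continuous and nondecreasing with k(0) = 0, and the Lebesgue–Stieltjes integral ∫_0^T (x − s) dk equals 0. Then necessarily k(t) = sup_{0 ≤ u ≤ t} (y(u) − s(u))⁻ for all t ∈ [0,T]; in particular the pair (x, k) is unique. -/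
open MeasureTheory Set

/-- If the nonnegative continuous function `f` has vanishing integral against the
Lebesgue–Stieltjes measure of `k`, then `k` does not increase over an interval where `f > 0`. -/
theorem IsStieltjesMeasureOn.le_of_setIntegral_eq_zero {k f : ℝ → ℝ} {T : ℝ} {μ : Measure ℝ}
    (hμ : IsStieltjesMeasureOn k T μ) (hT : 0 ≤ T) (hf : ContinuousOn f (Icc 0 T))
    (hf0 : ∀ u ∈ Icc 0 T, 0 ≤ f u) (hi : ∫ u in Ioc 0 T, f u ∂μ = 0)
    {a b : ℝ} (ha : 0 ≤ a) (hab : a ≤ b) (hb : b ≤ T) (hpos : ∀ u ∈ Ioc a b, 0 < f u) :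
    k b ≤ k a := by
  have hfin : μ (Ioc 0 T) < ⊤ := by
    rw [hμ 0 T le_rfl hT le_rfl]
    exact ENNReal.ofReal_lt_top
  obtain ⟨C, hC⟩ := isCompact_Icc.exists_bound_of_continuousOn hf
  have hint : IntegrableOn f (Ioc 0 T) μ := by
    refine IntegrableOn.of_bound hfin
      ((hf.mono Ioc_subset_Icc_self).aestronglyMeasurable measurableSet_Ioc) C ?_
    filter_upwards [ae_restrict_mem measurableSet_Ioc] with u hu
    exact hC u (Ioc_subset_Icc_self hu)
  have hnonneg : 0 ≤ᵐ[μ.restrict (Ioc 0 T)] f := by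
    filter_upwards [ae_restrict_mem measurableSet_Ioc] with u hu
    exact hf0 u (Ioc_subset_Icc_self hu)
  have hzero : f =ᵐ[μ.restrict (Ioc 0 T)] 0 :=
    (setIntegral_eq_zero_iff_of_nonneg_ae hnonneg hint).1 hi
  have hnull : μ (Ioc a b) = 0 := by
    refine measure_mono_null (fun u hu => ?_)
      (ae_iff.1 ((ae_restrict_iff' measurableSet_Ioc).1 hzero))
    exact fun h => (hpos u hu).ne' (h (Ioc_subset_Ioc ha hb hu))
  rw [hμ a b ha hab hb, ENNReal.ofReal_eq_zero] at hnull
  linarith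

/-- Skorokhod problem with a continuous lower obstacle `S`: uniqueness part.
Any solution `(x, k)` of the Skorokhod problem with obstacle `S` has its
reflecting term given by `k t = sup_{0 ≤ u ≤ t} (y u - S u)⁻`; in particular
the pair `(x, k)` is unique. -/
theorem skorokhod_obstacle_uniqueness
    (T : ℝ) (hT : 0 < T) (y S : ℝ → ℝ)
    (hy : ContinuousOn y (Icc 0 T)) (hS : ContinuousOn S (Icc 0 T))
    (h0 : S 0 ≤ y 0)
    (x k : ℝ → ℝ) (hxk : ∀ t ∈ Icc 0 T, x t = y t + k t)
    (hxc : ContinuousOn x (Icc 0 T)) (hobs : ∀ t ∈ Icc 0 T, S t ≤ x t)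
    (hkc : ContinuousOn k (Icc 0 T)) (hkm : MonotoneOn k (Icc 0 T)) (hk0 : k 0 = 0)
    (μ : Measure ℝ) (hμ : IsStieltjesMeasureOn k T μ)
    (hi : ∫ t in Ioc 0 T, (x t - S t) ∂μ = 0) :
    ∀ t ∈ Icc 0 T, k t = sSup ((fun u => max (-(y u - S u)) 0) '' Icc 0 t) := by
  rintro t ⟨ht0, htT⟩
  have hsub : Icc 0 t ⊆ Icc 0 T := Icc_subset_Icc_right htT
  refine (IsLUB.csSup_eq ⟨?_, fun M hM => ?_⟩ ((nonempty_Icc.2 ht0).image _)).symm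
  · rintro _ ⟨u, hu, rfl⟩
    have hkut : k u ≤ k t := hkm (hsub hu) ⟨ht0, htT⟩ hu.2
    have hk0u : k 0 ≤ k u := hkm ⟨le_rfl, hT.le⟩ (hsub hu) hu.1
    have hSx := hobs u (hsub hu)
    rw [hxk u (hsub hu)] at hSx
    exact max_le (by linarith) (by linarith)
  · have hbound : ∀ u ∈ Icc 0 t, max (-(y u - S u)) 0 ≤ M := fun u hu => hM ⟨u, hu, rfl⟩
    have hM0 : 0 ≤ M := (le_max_right _ _).trans (hbound 0 ⟨le_rfl, ht0⟩)
    have hclosed : IsClosed (Icc 0 t ∩ k ⁻¹' Iic M) :=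
      (hkc.mono hsub).preimage_isClosed_of_isClosed isClosed_Icc isClosed_Iic
    obtain ⟨a, ⟨ha, hkaM⟩, hmax⟩ :=
      (isCompact_Icc.of_isClosed_subset hclosed inter_subset_left).exists_isGreatest
        ⟨0, ⟨le_rfl, ht0⟩, hk0.trans_le hM0⟩
    refine le_trans ?_ hkaM
    refine hμ.le_of_setIntegral_eq_zero hT.le (hxc.sub hS)
      (fun u hu => sub_nonneg.2 (hobs u hu)) hi ha.1 ha.2 htT fun u hu => ?_
    have hut : u ∈ Icc 0 t := ⟨ha.1.trans hu.1.le, hu.2⟩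
    have hku : M < k u := not_le.1 fun h => (hmax ⟨hut, h⟩).not_gt hu.1
    have hyS := (le_max_left _ _).trans (hbound u hut)
    have hx := hxk u (hsub hut)
    simp only [Pi.sub_apply]
    linarith
end

section
/- Let T > 0 and let y¹, y² : [0,T] → ℝ be continuous functions with y¹(0) ≥ 0 and y²(0) ≥ 0. For i = 1, 2 define kⁱ(t) = sup_{0 ≤ s ≤ t} (yⁱ(s))⁻ and xⁱ = yⁱ + kⁱ. Then for every t ∈ [0,T]: |k¹(t) − k²(t)| ≤ sup_{0 ≤ s ≤ t} |y¹(s) − y²(s)| and |x¹(t) − x²(t)| ≤ 2 · sup_{0 ≤ s ≤ t} |y¹(s) − y²(s)|. In particular the Skorokhod map y ↦ (x, k) is Lipschitz continuous in the supremum norm. -/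
open Set

/-- If `f ≤ g + d` on a nonempty set on which `g` is bounded above, then `sup f ≤ sup g + d`. -/
theorem sSup_image_le_sSup_image_add {α : Type*} {f g : α → ℝ} {s : Set α} {d : ℝ}
    (hs : s.Nonempty) (hg : BddAbove (g '' s)) (h : ∀ a ∈ s, f a ≤ g a + d) :
    sSup (f '' s) ≤ sSup (g '' s) + d := by
  refine csSup_le (hs.image f) ?_
  rintro _ ⟨a, ha, rfl⟩
  linarith [h a ha, le_csSup hg (mem_image_of_mem g ha)]

/-- The supremum over a nonempty set is nonexpansive in the uniform distance. -/
theorem abs_sSup_image_sub_sSup_image_le {α : Type*} {f g : α → ℝ} {s : Set α} {d : ℝ}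
    (hs : s.Nonempty) (hf : BddAbove (f '' s)) (hg : BddAbove (g '' s))
    (h : ∀ a ∈ s, |f a - g a| ≤ d) :
    |sSup (f '' s) - sSup (g '' s)| ≤ d := by
  have hfg : sSup (f '' s) ≤ sSup (g '' s) + d :=
    sSup_image_le_sSup_image_add hs hg fun a ha => by linarith [(abs_le.mp (h a ha)).2]
  have hgf : sSup (g '' s) ≤ sSup (f '' s) + d :=
    sSup_image_le_sSup_image_add hs hf fun a ha => by linarith [(abs_le.mp (h a ha)).1]
  exact abs_le.mpr ⟨by linarith, by linarith⟩

/-- Lipschitz continuity of the Skorokhod map in the supremum norm: for two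
continuous inputs `y₁, y₂` with nonnegative initial values and solutions
`(x₁, k₁)`, `(x₂, k₂)` given by the explicit formulas, one has
`|k₁ t - k₂ t| ≤ sup_{0 ≤ s ≤ t} |y₁ s - y₂ s|` and
`|x₁ t - x₂ t| ≤ 2 · sup_{0 ≤ s ≤ t} |y₁ s - y₂ s|`. -/
theorem skorokhod_map_lipschitz
    (T : ℝ) (hT : 0 < T) (y₁ y₂ : ℝ → ℝ)
    (hy₁ : ContinuousOn y₁ (Icc 0 T)) (hy₂ : ContinuousOn y₂ (Icc 0 T))
    (hy₁0 : 0 ≤ y₁ 0) (hy₂0 : 0 ≤ y₂ 0)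
    (k₁ k₂ x₁ x₂ : ℝ → ℝ)
    (hk₁ : ∀ t ∈ Icc 0 T, k₁ t = sSup ((fun s => max (-(y₁ s)) 0) '' Icc 0 t))
    (hk₂ : ∀ t ∈ Icc 0 T, k₂ t = sSup ((fun s => max (-(y₂ s)) 0) '' Icc 0 t))
    (hx₁ : ∀ t ∈ Icc 0 T, x₁ t = y₁ t + k₁ t)
    (hx₂ : ∀ t ∈ Icc 0 T, x₂ t = y₂ t + k₂ t) :
    ∀ t ∈ Icc 0 T,
      |k₁ t - k₂ t| ≤ sSup ((fun s => |y₁ s - y₂ s|) '' Icc 0 t) ∧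
      |x₁ t - x₂ t| ≤ 2 * sSup ((fun s => |y₁ s - y₂ s|) '' Icc 0 t) := by
  intro t ht
  have hsub : Icc 0 t ⊆ Icc 0 T := Icc_subset_Icc_right ht.2
  have hc₁ := hy₁.mono hsub
  have hc₂ := hy₂.mono hsub
  have hdist : ∀ s ∈ Icc 0 t, |y₁ s - y₂ s| ≤ sSup ((fun s => |y₁ s - y₂ s|) '' Icc 0 t) :=
    fun s hs => le_csSup (isCompact_Icc.bddAbove_image (hc₁.sub hc₂).abs)
      (mem_image_of_mem (fun s => |y₁ s - y₂ s|) hs)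
  have hk : |k₁ t - k₂ t| ≤ sSup ((fun s => |y₁ s - y₂ s|) '' Icc 0 t) := by
    rw [hk₁ t ht, hk₂ t ht]
    refine abs_sSup_image_sub_sSup_image_le (nonempty_Icc.mpr ht.1)
      (isCompact_Icc.bddAbove_image (hc₁.neg.sup continuousOn_const))
      (isCompact_Icc.bddAbove_image (hc₂.neg.sup continuousOn_const)) fun s hs => ?_
    calc |max (-(y₁ s)) 0 - max (-(y₂ s)) 0| ≤ |-(y₁ s) - -(y₂ s)| :=
          abs_max_sub_max_le_abs _ _ _
      _ = |y₁ s - y₂ s| := by rw [neg_sub_neg, abs_sub_comm]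
      _ ≤ _ := hdist s hs
  refine ⟨hk, ?_⟩
  rw [hx₁ t ht, hx₂ t ht, add_sub_add_comm]
  linarith [abs_add_le (y₁ t - y₂ t) (k₁ t - k₂ t), hdist t (right_mem_Icc.mpr ht.1)]
end

section
/- Let T > 0. Let x¹, x², s¹, s² : [0,T] → ℝ be continuous functions and k¹, k² : [0,T] → ℝ be continuous nondecreasing functions with k¹(0) = k²(0) = 0, such that for i = 1, 2: xⁱ(t) ≥ sⁱ(t) for all t ∈ [0,T] and the Lebesgue–Stieltjes integral ∫_0^T (xⁱ − sⁱ) dkⁱ = 0. Assume moreover s¹(t) ≤ s²(t) for all t ∈ [0,T]. Then for every t ∈ [0,T]: ∫_0^t ((x¹(u) − x²(u))⁺)² dk¹(u) = 0, and consequently ∫_0^t ((x¹(u) − x²(u))⁺)² dk¹(u) − ∫_0^t ((x¹(u) − x²(u))⁺)² dk²(u) ≤ 0. -/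
open MeasureTheory Set

/-- A Lebesgue–Stieltjes measure on `[0,T]` is finite on `(0,T]`. -/
theorem IsStieltjesMeasureOn.measure_Ioc_lt_top {k : ℝ → ℝ} {T : ℝ} {μ : Measure ℝ}
    (hμ : IsStieltjesMeasureOn k T μ) (hT : 0 ≤ T) : μ (Ioc 0 T) < ⊤ := by
  rw [hμ 0 T le_rfl hT le_rfl]
  exact ENNReal.ofReal_lt_top

/-- A function continuous on `[a,b]` is integrable on `(a,b]` for any measure that is finite
on `(a,b]`, even if it charges `a` with infinite mass. -/
theorem ContinuousOn.integrableOn_Ioc_of_measure_lt_top {f : ℝ → ℝ} {a b : ℝ} {μ : Measure ℝ}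
    (hf : ContinuousOn f (Icc a b)) (hμ : μ (Ioc a b) < ⊤) : IntegrableOn f (Ioc a b) μ := by
  obtain ⟨C, hC⟩ := isCompact_Icc.exists_bound_of_continuousOn hf
  refine IntegrableOn.of_bound hμ
    ((hf.mono Ioc_subset_Icc_self).aestronglyMeasurable measurableSet_Ioc) C ?_
  filter_upwards [ae_restrict_mem measurableSet_Ioc] with u hu
  exact hC u (Ioc_subset_Icc_self hu)

/-- Key pathwise step of the comparison theorem for reflected G-SDEs: if
`xⁱ ≥ sⁱ`, `∫_0^T (xⁱ - sⁱ) dkⁱ = 0` for `i = 1, 2` and `s¹ ≤ s²`, then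
`∫_0^t ((x¹-x²)⁺)² dk¹ = 0` and hence
`∫_0^t ((x¹-x²)⁺)² dk¹ - ∫_0^t ((x¹-x²)⁺)² dk² ≤ 0` for all `t ∈ [0,T]`. -/
theorem comparison_key_step
    (T : ℝ) (hT : 0 < T)
    (x₁ x₂ s₁ s₂ k₁ k₂ : ℝ → ℝ)
    (hx₁ : ContinuousOn x₁ (Icc 0 T)) (hx₂ : ContinuousOn x₂ (Icc 0 T))
    (hs₁ : ContinuousOn s₁ (Icc 0 T)) (hs₂ : ContinuousOn s₂ (Icc 0 T))
    (hk₁c : ContinuousOn k₁ (Icc 0 T)) (hk₂c : ContinuousOn k₂ (Icc 0 T))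
    (hk₁m : MonotoneOn k₁ (Icc 0 T)) (hk₂m : MonotoneOn k₂ (Icc 0 T))
    (hk₁0 : k₁ 0 = 0) (hk₂0 : k₂ 0 = 0)
    (hobs₁ : ∀ t ∈ Icc 0 T, s₁ t ≤ x₁ t) (hobs₂ : ∀ t ∈ Icc 0 T, s₂ t ≤ x₂ t)
    (μ₁ μ₂ : Measure ℝ)
    (hμ₁ : IsStieltjesMeasureOn k₁ T μ₁) (hμ₂ : IsStieltjesMeasureOn k₂ T μ₂)
    (hi₁ : ∫ t in Ioc 0 T, (x₁ t - s₁ t) ∂μ₁ = 0)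
    (hi₂ : ∫ t in Ioc 0 T, (x₂ t - s₂ t) ∂μ₂ = 0)
    (hss : ∀ t ∈ Icc 0 T, s₁ t ≤ s₂ t) :
    ∀ t ∈ Icc 0 T,
      (∫ u in Ioc 0 t, max (x₁ u - x₂ u) 0 ^ 2 ∂μ₁) = 0 ∧
      (∫ u in Ioc 0 t, max (x₁ u - x₂ u) 0 ^ 2 ∂μ₁) -
        (∫ u in Ioc 0 t, max (x₁ u - x₂ u) 0 ^ 2 ∂μ₂) ≤ 0 := by
  intro t ht
  have hint : IntegrableOn (fun u => x₁ u - s₁ u) (Ioc 0 T) μ₁ :=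
    (hx₁.sub hs₁).integrableOn_Ioc_of_measure_lt_top (hμ₁.measure_Ioc_lt_top hT.le)
  have hnonneg : 0 ≤ᵐ[μ₁.restrict (Ioc 0 T)] fun u => x₁ u - s₁ u := by
    filter_upwards [ae_restrict_mem measurableSet_Ioc] with u hu
    exact sub_nonneg.2 (hobs₁ u (Ioc_subset_Icc_self hu))
  have hcontact : (fun u => x₁ u - s₁ u) =ᵐ[μ₁.restrict (Ioc 0 T)] 0 :=
    (setIntegral_eq_zero_iff_of_nonneg_ae hnonneg hint).1 hi₁
  have hzero : ∫ u in Ioc 0 t, max (x₁ u - x₂ u) 0 ^ 2 ∂μ₁ = 0 := by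
    refine integral_eq_zero_of_ae ?_
    filter_upwards [ae_restrict_of_ae_restrict_of_subset (Ioc_subset_Ioc_right ht.2) hcontact,
      ae_restrict_mem measurableSet_Ioc] with u hu hut
    have huT : u ∈ Icc 0 T := ⟨hut.1.le, hut.2.trans ht.2⟩
    have hle : x₁ u - x₂ u ≤ 0 := by
      have hu' : x₁ u - s₁ u = 0 := hu
      linarith [hss u huT, hobs₂ u huT]
    simp [max_eq_right hle]
  refine ⟨hzero, ?_⟩
  rw [hzero, zero_sub, neg_nonpos]
  exact integral_nonneg fun u => sq_nonneg _
end
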